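/- Let A ∈ ℝ^{nd×nd} be symmetric, let Λ ∈ ℝ^{nd×nd} be block-diagonal (with d×d diagonal blocks Λ_{11},…,Λ_{nn}), and suppose there exists S ∈ St(d,p)^{⊗n} such that (Λ − A)S = 0 and Λ − A is positive semidefinite. Then X := SSᵀ is a global maximizer of the SDP relaxation. If in addition rank(Λ − A) = (n−1)d, then X is the unique global maximizer of the SDP relaxation and rank(X) = d; consequently X = R̂R̂ᵀ for some R̂ ∈ ℝ^{nd×d} with orthogonal d×d blocks that is a global maximizer of the program (P). -/

import Mathlib

open Matrix MeasureTheory ProbabilityTheory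
open scoped BigOperators ENNReal

noncomputable section

/-- Frobenius inner product `⟨X, Y⟩ = Tr (X Yᵀ)`. -/
def finner {m k : Type*} [Fintype m] [Fintype k] (X Y : Matrix m k ℝ) : ℝ :=
  ∑ i, ∑ j, X i j * Y i j

/-- Frobenius norm. -/
def frobNorm {m k : Type*} [Fintype m] [Fintype k] (X : Matrix m k ℝ) : ℝ :=
  Real.sqrt (∑ i, ∑ j, (X i j) ^ 2)

/-- Spectral (ℓ²-operator) norm of a real matrix. -/
def opNorm {m k : Type*} [Fintype m] [Fintype k] [DecidableEq k] (X : Matrix m k ℝ) : ℝ :=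
  ‖LinearMap.toContinuousLinearMap (Matrix.toEuclideanLin X)‖

/-- The `(i,j)` d×d block of an (nd)×(nd) matrix. -/
def blk {n d : ℕ} (M : Matrix (Fin n × Fin d) (Fin n × Fin d) ℝ) (i j : Fin n) :
    Matrix (Fin d) (Fin d) ℝ := fun k l => M (i, k) (j, l)

/-- The i-th d×p block row of an (nd)×p matrix. -/
def rowBlk {n d p : ℕ} (S : Matrix (Fin n × Fin d) (Fin p) ℝ) (i : Fin n) :
    Matrix (Fin d) (Fin p) ℝ := fun k l => S (i, k) l

/-- The i-th (nd)×d block column of an (nd)×(nd) matrix. -/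
def colBlk {n d : ℕ} (M : Matrix (Fin n × Fin d) (Fin n × Fin d) ℝ) (i : Fin n) :
    Matrix (Fin n × Fin d) (Fin d) ℝ := fun q l => M q (i, l)

/-- All d×p block rows lie in the Stiefel manifold St(d,p) (for p = d: are orthogonal). -/
def StiefelBlocks {n d p : ℕ} (S : Matrix (Fin n × Fin d) (Fin p) ℝ) : Prop :=
  ∀ i, rowBlk S i * (rowBlk S i)ᵀ = 1

/-- The vertical stack Z of n copies of the identity I_d. -/
def Zmat (n d : ℕ) : Matrix (Fin n × Fin d) (Fin d) ℝ := fun q l => if q.2 = l then 1 else 0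

/-- Feasibility for the SDP relaxation: symmetric, PSD, identity diagonal blocks. -/
def sdpFeasible {n d : ℕ} (X : Matrix (Fin n × Fin d) (Fin n × Fin d) ℝ) : Prop :=
  X.IsSymm ∧ X.PosSemidef ∧ ∀ i, blk X i i = 1

/-- Global maximizer of the SDP relaxation with data `A`. -/
def sdpMaximizer {n d : ℕ} (A X : Matrix (Fin n × Fin d) (Fin n × Fin d) ℝ) : Prop :=
  sdpFeasible X ∧ ∀ Y, sdpFeasible Y → finner A Y ≤ finner A X

/-- Global maximizer of the program (P) with data `A`. -/
def progPMaximizer {n d : ℕ} (A : Matrix (Fin n × Fin d) (Fin n × Fin d) ℝ)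
    (R : Matrix (Fin n × Fin d) (Fin d) ℝ) : Prop :=
  StiefelBlocks R ∧
    ∀ R' : Matrix (Fin n × Fin d) (Fin d) ℝ, StiefelBlocks R' →
      finner A (R' * R'ᵀ) ≤ finner A (R * Rᵀ)

/-- The distance `d_F(S, Z) = min_{Q ∈ St(d,p)} ‖S − ZQ‖_F`. -/
def dF {n d p : ℕ} (S : Matrix (Fin n × Fin d) (Fin p) ℝ) : ℝ :=
  sInf {c | ∃ Q : Matrix (Fin d) (Fin p) ℝ, Q * Qᵀ = 1 ∧ c = frobNorm (S - Zmat n d * Q)}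

/-- `Λ_{ii}(S) = (1/2) Σ_j (S_i S_jᵀ A_{ji} + A_{ij} S_j S_iᵀ)`. -/
def Lam {n d p : ℕ} (A : Matrix (Fin n × Fin d) (Fin n × Fin d) ℝ)
    (S : Matrix (Fin n × Fin d) (Fin p) ℝ) (i : Fin n) : Matrix (Fin d) (Fin d) ℝ :=
  (1 / 2 : ℝ) •
    ∑ j, (rowBlk S i * (rowBlk S j)ᵀ * blk A j i + blk A i j * rowBlk S j * (rowBlk S i)ᵀ)

/-- Block diagonal matrix with given d×d diagonal blocks. -/
def blkDiag {n d : ℕ} (D : Fin n → Matrix (Fin d) (Fin d) ℝ) :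
    Matrix (Fin n × Fin d) (Fin n × Fin d) ℝ :=
  fun q r => if q.1 = r.1 then D q.1 q.2 r.2 else 0

/-- Local maximizer of `f(S) = ⟨A, S Sᵀ⟩` over `St(d,p)^{⊗n}`. -/
def isLocalMax {n d p : ℕ} (A : Matrix (Fin n × Fin d) (Fin n × Fin d) ℝ)
    (S : Matrix (Fin n × Fin d) (Fin p) ℝ) : Prop :=
  StiefelBlocks S ∧ ∃ ε > (0 : ℝ), ∀ S' : Matrix (Fin n × Fin d) (Fin p) ℝ,
    StiefelBlocks S' → frobNorm (S' - S) < ε → finner A (S' * S'ᵀ) ≤ finner A (S * Sᵀ)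

/-- First-order criticality: `Σ_j A_{ij} S_j = Λ_{ii}(S) S_i` for all i. -/
def firstOrderCrit {n d p : ℕ} (A : Matrix (Fin n × Fin d) (Fin n × Fin d) ℝ)
    (S : Matrix (Fin n × Fin d) (Fin p) ℝ) : Prop :=
  ∀ i, (∑ j, blk A i j * rowBlk S j) = Lam A S i * rowBlk S i

/-- Second-order necessary inequality over tangent directions. -/
def secondOrderIneq {n d p : ℕ} (A : Matrix (Fin n × Fin d) (Fin n × Fin d) ℝ)
    (S : Matrix (Fin n × Fin d) (Fin p) ℝ) : Prop :=
  ∀ Y : Matrix (Fin n × Fin d) (Fin p) ℝ,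
    (∀ i, rowBlk S i * (rowBlk Y i)ᵀ + rowBlk Y i * (rowBlk S i)ᵀ = 0) →
    ∑ i, ∑ j, finner (blk A i j) (rowBlk Y i * (rowBlk Y j)ᵀ) ≤
      ∑ i, finner (Lam A S i) (rowBlk Y i * (rowBlk Y i)ᵀ)

/-- Second-order critical point of `f`. -/
def secondOrderCrit {n d p : ℕ} (A : Matrix (Fin n × Fin d) (Fin n × Fin d) ℝ)
    (S : Matrix (Fin n × Fin d) (Fin p) ℝ) : Prop :=
  StiefelBlocks S ∧ firstOrderCrit A S ∧ secondOrderIneq A S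

/-- Partial trace `Tr_d(Δ) ∈ ℝ^{n×n}`. -/
def partialTrace {n d : ℕ} (Δ : Matrix (Fin n × Fin d) (Fin n × Fin d) ℝ) :
    Matrix (Fin n) (Fin n) ℝ := fun i j => (blk Δ i j).trace

/-- Singular values of a d×p real matrix (square roots of the eigenvalues of `M Mᴴ`). -/
def singVals {d p : ℕ} (M : Matrix (Fin d) (Fin p) ℝ) (i : Fin d) : ℝ :=
  Real.sqrt ((Matrix.isHermitian_mul_conjTranspose_self M).eigenvalues i)

/-- Nuclear norm: sum of singular values. -/
def nuclearNorm {d p : ℕ} (M : Matrix (Fin d) (Fin p) ℝ) : ℝ :=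
  ∑ i, singVals M i

/-- The law of the iid standard Gaussian coordinates indexing the noise. -/
def gaussianEnsemble (n d : ℕ) :
    Measure (((Fin n × Fin d) × (Fin n × Fin d)) → ℝ) :=
  Measure.pi fun _ => gaussianReal 0 1

/-- The symmetric Gaussian random matrix `W` built from the iid coordinates:
`W_{ii} = 0`, the entries of `W_{ij}` for `i < j` are iid standard Gaussians, and
`W_{ji} = W_{ij}ᵀ`. -/
def Wof {n d : ℕ} (ω : ((Fin n × Fin d) × (Fin n × Fin d)) → ℝ) :
    Matrix (Fin n × Fin d) (Fin n × Fin d) ℝ :=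
  fun q r => if q.1 < r.1 then ω (q, r) else if r.1 < q.1 then ω (r, q) else 0

lemma finner_eq_trace {m k : Type*} [Fintype m] [Fintype k] (X Y : Matrix m k ℝ) :
    finner X Y = (X * Yᵀ).trace := by
  simp [finner, Matrix.trace, Matrix.mul_apply]

lemma finner_sub_left {m k : Type*} [Fintype m] [Fintype k] (X X' Y : Matrix m k ℝ) :
    finner (X - X') Y = finner X Y - finner X' Y := by
  simp [finner, sub_mul, Finset.sum_sub_distrib]

open scoped MatrixOrder in
/-- The trace of a product of two positive semidefinite matrices is nonnegative, and it vanishes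
only if the product does. -/
lemma Matrix.PosSemidef.trace_mul_nonneg_and_mul_eq_zero {m : Type*} [Fintype m] [DecidableEq m]
    {L Y : Matrix m m ℝ} (hL : L.PosSemidef) (hY : Y.PosSemidef) :
    0 ≤ (L * Y).trace ∧ ((L * Y).trace = 0 → L * Y = 0) := by
  obtain ⟨B, hB⟩ := CStarAlgebra.nonneg_iff_eq_star_mul_self.mp hL.nonneg
  obtain ⟨C, hC⟩ := CStarAlgebra.nonneg_iff_eq_star_mul_self.mp hY.nonneg
  rw [Matrix.star_eq_conjTranspose] at hB hC
  subst hB hC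
  have key : (Bᴴ * B * (Cᴴ * C)).trace = ((B * Cᴴ)ᴴ * (B * Cᴴ)).trace := by
    rw [Matrix.conjTranspose_mul, Matrix.conjTranspose_conjTranspose, ← Matrix.mul_assoc,
      Matrix.trace_mul_comm]
    simp only [Matrix.mul_assoc]
  rw [key]
  refine ⟨(Matrix.posSemidef_conjTranspose_mul_self _).trace_nonneg, fun h => ?_⟩
  have h0 := Matrix.trace_conjTranspose_mul_self_eq_zero_iff.mp h
  rw [Matrix.mul_assoc, ← Matrix.mul_assoc B, h0, Matrix.zero_mul, Matrix.mul_zero]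

/-- A block-diagonal matrix has the same inner product with all matrices sharing their diagonal
blocks. -/
lemma finner_congr_of_blockDiagonal {n d : ℕ} {Λ X Y : Matrix (Fin n × Fin d) (Fin n × Fin d) ℝ}
    (hΛ : ∀ q r : Fin n × Fin d, q.1 ≠ r.1 → Λ q r = 0) (h : ∀ i, blk X i i = blk Y i i) :
    finner Λ X = finner Λ Y := by
  refine Finset.sum_congr rfl fun q _ => Finset.sum_congr rfl fun r _ => ?_
  obtain ⟨i, k⟩ := q
  obtain ⟨j, l⟩ := r
  by_cases hij : i = j
  · subst hij
    congr 1
    exact congrFun (congrFun (h i) k) l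
  · rw [hΛ _ _ hij, zero_mul, zero_mul]

lemma blk_mul_transpose {n d p : ℕ} (S : Matrix (Fin n × Fin d) (Fin p) ℝ) (i j : Fin n) :
    blk (S * Sᵀ) i j = rowBlk S i * (rowBlk S j)ᵀ := rfl

lemma StiefelBlocks.sdpFeasible {n d p : ℕ} {S : Matrix (Fin n × Fin d) (Fin p) ℝ}
    (hS : StiefelBlocks S) : sdpFeasible (S * Sᵀ) :=
  ⟨by simp [Matrix.IsSymm, Matrix.transpose_mul],
    by simpa using Matrix.posSemidef_self_mul_conjTranspose S, hS⟩

lemma rank_eq_of_rowBlk_eq_one {n d : ℕ} {R : Matrix (Fin n × Fin d) (Fin d) ℝ} {i : Fin n}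
    (hR : rowBlk R i = 1) : R.rank = d := by
  refine le_antisymm (by simpa using R.rank_le_card_width) ?_
  have h : (R.submatrix (fun k => (i, k)) (Equiv.refl _)).rank ≤ R.rank :=
    Matrix.rank_submatrix_le _ _ _
  have h1 : R.submatrix (fun k => (i, k)) (Equiv.refl _) = 1 := hR
  rw [h1, Matrix.rank_one, Fintype.card_fin] at h
  exact h

/-- If the columns of `R` span the kernel of `L` and the `i`-th block of `R` is the identity, then
a matrix annihilated by `L` is determined by its `i`-th block row. -/
lemma eq_mul_rowBlk_of_mul_eq_zero {n d : ℕ} {m : Type*}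
    {L : Matrix (Fin n × Fin d) (Fin n × Fin d) ℝ} {R : Matrix (Fin n × Fin d) (Fin d) ℝ}
    {i : Fin n} (hrank : L.rank = (n - 1) * d) (hLR : L * R = 0) (hR : rowBlk R i = 1)
    (Y : Matrix (Fin n × Fin d) m ℝ) (hY : L * Y = 0) :
    Y = R * Y.submatrix (fun k => (i, k)) id := by
  have hle : LinearMap.range R.mulVecLin ≤ LinearMap.ker L.mulVecLin := by
    rintro _ ⟨w, rfl⟩
    simp [Matrix.mulVec_mulVec, hLR]
  have hdim : Module.finrank ℝ (LinearMap.range R.mulVecLin) =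
      Module.finrank ℝ (LinearMap.ker L.mulVecLin) := by
    have h1 := LinearMap.finrank_range_add_finrank_ker L.mulVecLin
    have h2 : Module.finrank ℝ (LinearMap.range R.mulVecLin) = d := rank_eq_of_rowBlk_eq_one hR
    have h3 : Module.finrank ℝ (LinearMap.range L.mulVecLin) = (n - 1) * d := hrank
    have h4 : n * d = (n - 1) * d + d := by
      obtain ⟨k, rfl⟩ : ∃ k, n = k + 1 := ⟨n - 1, by have := i.pos; omega⟩
      simp [Nat.succ_mul]
    simp only [Module.finrank_fintype_fun_eq_card, Fintype.card_prod, Fintype.card_fin] at h1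
    omega
  have heq := Submodule.eq_of_le_of_finrank_eq hle hdim
  ext q j
  have hmem : (fun q => Y q j) ∈ LinearMap.range R.mulVecLin := by
    rw [heq, LinearMap.mem_ker]
    ext r
    exact congrFun (congrFun hY r) j
  obtain ⟨w, hw⟩ := hmem
  have hw' : ∀ q, (R *ᵥ w) q = Y q j := fun q => congrFun hw q
  have hblk : (fun k => Y (i, k) j) = w := by
    ext k
    rw [← hw']
    change (rowBlk R i *ᵥ w) k = w k
    rw [hR, Matrix.one_mulVec]
  rw [← hw', ← hblk]
  rfl

/-- certifying global optimality via a dual certificate (Proposition 5.1). -/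
theorem dual_certificate {n d p : ℕ} (hn : 2 ≤ n) (hd : 1 ≤ d) (hp : d ≤ p)
    (A : Matrix (Fin n × Fin d) (Fin n × Fin d) ℝ) (hAsym : A.IsSymm)
    (Λ : Matrix (Fin n × Fin d) (Fin n × Fin d) ℝ)
    (hΛblkdiag : ∀ q r : Fin n × Fin d, q.1 ≠ r.1 → Λ q r = 0)
    (S : Matrix (Fin n × Fin d) (Fin p) ℝ) (hS : StiefelBlocks S)
    (hker : (Λ - A) * S = 0) (hpsd : (Λ - A).PosSemidef) :
    sdpMaximizer A (S * Sᵀ) ∧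
    ((Λ - A).rank = (n - 1) * d →
      (∀ Y, sdpMaximizer A Y → Y = S * Sᵀ) ∧
      (S * Sᵀ).rank = d ∧
      ∃ R : Matrix (Fin n × Fin d) (Fin d) ℝ,
        progPMaximizer A R ∧ S * Sᵀ = R * Rᵀ) := by
  have hfeas := hS.sdpFeasible
  have hsplit : ∀ Y, sdpFeasible Y →
      finner A (S * Sᵀ) - finner A Y = ((Λ - A) * Y).trace := by
    intro Y hY
    have h0 : finner (Λ - A) (S * Sᵀ) = 0 := by
      rw [finner_eq_trace, hfeas.1.eq, ← Matrix.mul_assoc, hker]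
      simp
    have h1 := finner_eq_trace (Λ - A) Y
    rw [hY.1.eq] at h1
    rw [finner_sub_left] at h0 h1
    have h2 : finner Λ Y = finner Λ (S * Sᵀ) :=
      finner_congr_of_blockDiagonal hΛblkdiag fun i => by rw [hY.2.2 i, hfeas.2.2 i]
    linarith
  have hmax : sdpMaximizer A (S * Sᵀ) := by
    refine ⟨hfeas, fun Y hY => ?_⟩
    have := (hpsd.trace_mul_nonneg_and_mul_eq_zero hY.2.1).1
    have := hsplit Y hY
    linarith
  refine ⟨hmax, fun hrank => ?_⟩
  let i : Fin n := ⟨0, by omega⟩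
  set R : Matrix (Fin n × Fin d) (Fin d) ℝ := S * (rowBlk S i)ᵀ with hRdef
  have hRi : rowBlk R i = 1 := hS i
  have hLR : (Λ - A) * R = 0 := by rw [hRdef, ← Matrix.mul_assoc, hker, Matrix.zero_mul]
  have hfactor : ∀ Y, sdpFeasible Y → (Λ - A) * Y = 0 → Y = R * Rᵀ := by
    intro Y hY hLY
    have h := eq_mul_rowBlk_of_mul_eq_zero hrank hLR hRi Y hLY
    have hcol : (Λ - A) * colBlk Y i = 0 := by
      ext q k
      exact congrFun (congrFun hLY q) (i, k)
    have hR : colBlk Y i = R := by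
      have h' := eq_mul_rowBlk_of_mul_eq_zero hrank hLR hRi (colBlk Y i) hcol
      have h1 : (colBlk Y i).submatrix (fun k => (i, k)) id = 1 := hY.2.2 i
      rwa [h1, Matrix.mul_one] at h'
    have hrow : Y.submatrix (fun k => (i, k)) id = Rᵀ := by
      rw [← hR]
      ext k q
      exact hY.1.apply q (i, k)
    rwa [hrow] at h
  have hX : S * Sᵀ = R * Rᵀ :=
    hfactor _ hfeas (by rw [← Matrix.mul_assoc, hker, Matrix.zero_mul])
  have hRS : StiefelBlocks R := fun j => by
    rw [← blk_mul_transpose, ← hX, blk_mul_transpose, hS j]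
  refine ⟨fun Y hY => ?_, ?_, R, ⟨hRS, fun R' hR' => ?_⟩, hX⟩
  · have hle := hY.2 _ hfeas
    have hge := hmax.2 _ hY.1
    rw [hX]
    refine hfactor Y hY.1 ((hpsd.trace_mul_nonneg_and_mul_eq_zero hY.1.2.1).2 ?_)
    rw [← hsplit Y hY.1]
    linarith
  · rw [hX, Matrix.rank_self_mul_transpose, rank_eq_of_rowBlk_eq_one hRi]
  · rw [← hX]
    exact hmax.2 _ hR'.sdpFeasible
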